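/- Let X_n be random elements of A_n^{m(n)} distributed as PAG_κ(n, m(n)) with 2m(n)/n² → ρ ∈ (0,∞). Then X_n converges in probability (in the sense of multigraph homomorphism densities) to the multigraphon W(x,y,k) = p(k, F^{−1}(x)F^{−1}(y)/ρ) for x ≠ y and W(x,x,k) = 1[2|k]·p(k/2, F^{−1}(x)²/(2ρ)), where p(k,λ) = e^{−λ}λ^k/k! and F is the Gamma(κ, κ/ρ) cumulative distribution function. -/

import Mathlib

open Finset Nat MeasureTheory ProbabilityTheory Filter

/-- The number of balls of color `i` in the urn configuration `ψ`. -/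
def colorCount {M n : ℕ} (ψ : Fin M → Fin n) (i : Fin n) : ℕ :=
  (Finset.univ.filter fun l => ψ l = i).card

/-- The closed-form Pólya urn probability; its pushforward under the stub-pairing map is
the distribution of the preferential attachment graph `PAG_κ(n,m)`. -/
noncomputable def polyaProb (κ : ℝ) {M n : ℕ} (ψ : Fin M → Fin n) : ℝ :=
  (∏ i : Fin n, ∏ j ∈ Finset.range (colorCount ψ i), (κ + j)) /
    ∏ j ∈ Finset.range M, (κ * n + j)

/-- The adjacency matrix obtained from `ψ : [2m] → [n]` by the stub-pairing map. -/
def stubAdj {m n : ℕ} (ψ : Fin (2 * m) → Fin n) (i j : Fin n) : ℕ :=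
  ∑ e : Fin m,
    ((if ψ ⟨2 * (e : ℕ), by have := e.isLt; omega⟩ = i ∧
         ψ ⟨2 * (e : ℕ) + 1, by have := e.isLt; omega⟩ = j then 1 else 0) +
     (if ψ ⟨2 * (e : ℕ), by have := e.isLt; omega⟩ = j ∧
         ψ ⟨2 * (e : ℕ) + 1, by have := e.isLt; omega⟩ = i then 1 else 0))

/-- The induced homomorphism density `t_=(A,B) = n^{-k} ∑_{φ:[k]→[n]} 1[A = B∘(φ×φ)]`. -/
noncomputable def tind {k n : ℕ} (A : Fin k → Fin k → ℕ) (B : Fin n → Fin n → ℕ) : ℝ :=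
  (∑ f : Fin k → Fin n,
      if ∀ i j, A i j = B (f i) (f j) then (1:ℝ) else 0) / (n : ℝ) ^ k

/-- The uniform distribution on `[0,1]`. -/
noncomputable def unifI : Measure ℝ := volume.restrict (Set.Icc 0 1)

/-- The induced homomorphism density of `A` in a multigraphon `W`. -/
noncomputable def tindW {k : ℕ} (A : Fin k → Fin k → ℕ) (W : ℝ → ℝ → ℕ → ℝ) : ℝ :=
  ∫ x : Fin k → ℝ,
    ∏ i : Fin k, ∏ j : Fin k, (if i ≤ j then W (x i) (x j) (A i j) else 1)
    ∂ (Measure.pi fun _ : Fin k => unifI)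

/-- The cumulative distribution function of the `Gamma(κ, κ/ρ)` distribution. -/
noncomputable def gammaCDF (κ ρ z : ℝ) : ℝ :=
  ∫ x in Set.Iic z, gammaPDFReal κ (κ / ρ) x

/-- The generalized inverse `F⁻¹(u) = min{z : F(z) ≥ u}` of the `Gamma(κ,κ/ρ)` cdf. -/
noncomputable def gammaInv (κ ρ u : ℝ) : ℝ :=
  sInf {z : ℝ | u ≤ gammaCDF κ ρ z}

/-- The Poisson weight `p(c,λ) = e^{-λ} λ^c / c!`. -/
noncomputable def poissonWeight (c : ℕ) (lam : ℝ) : ℝ :=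
  Real.exp (-lam) * lam ^ c / (c !)

/-- The limiting multigraphon of the dense preferential attachment graph:
`W(x,y,c) = p(c, F⁻¹(x)F⁻¹(y)/ρ)` for `x ≠ y` and
`W(x,x,c) = 1[2∣c]·p(c/2, F⁻¹(x)²/(2ρ))`, `F` the `Gamma(κ,κ/ρ)` cdf. -/
noncomputable def Wpag (κ ρ : ℝ) (x y : ℝ) (c : ℕ) : ℝ :=
  if x = y then
    (if 2 ∣ c then poissonWeight (c / 2) (gammaInv κ ρ x * gammaInv κ ρ y / (2 * ρ))
     else 0)
  else poissonWeight c (gammaInv κ ρ x * gammaInv κ ρ y / ρ)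

/-- The unnormalised Pólya urn weight of a colour sequence `ψ` with initial masses `α`. -/
noncomputable def urnWeight {C : Type*} [Fintype C] [DecidableEq C] (α : C → ℝ) {M : ℕ}
    (ψ : Fin M → C) : ℝ :=
  ∏ c, ∏ j ∈ range #{l | ψ l = c}, (α c + j)

lemma urnWeight_nonneg {C : Type*} [Fintype C] [DecidableEq C] {α : C → ℝ} (hα : ∀ c, 0 ≤ α c)
    {M : ℕ} (ψ : Fin M → C) : 0 ≤ urnWeight α ψ :=
  prod_nonneg fun c _ => prod_nonneg fun _ _ => add_nonneg (hα c) (Nat.cast_nonneg _)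

lemma card_filter_cons {C : Type*} [DecidableEq C] {M : ℕ} (b c : C) (ψ : Fin M → C) :
    #{l | (Fin.cons b ψ : Fin (M + 1) → C) l = c} =
      (if b = c then 1 else 0) + #{l | ψ l = c} := by
  simp only [Finset.card_filter, Fin.sum_univ_succ, Fin.cons_zero, Fin.cons_succ]

lemma urnWeight_cons {C : Type*} [Fintype C] [DecidableEq C] (α : C → ℝ) {M : ℕ} (b : C)
    (ψ : Fin M → C) :
    urnWeight α (Fin.cons b ψ : Fin (M + 1) → C) =
      (α b + #{l | ψ l = b}) * urnWeight α ψ := by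
  unfold urnWeight
  rw [← mul_prod_erase univ _ (mem_univ b), ← mul_prod_erase univ _ (mem_univ b), ← mul_assoc]
  congr 1
  · rw [card_filter_cons, if_pos rfl, add_comm 1, prod_range_succ, mul_comm]
  · refine prod_congr rfl fun c hc => ?_
    rw [card_filter_cons, if_neg (ne_of_mem_erase hc).symm, zero_add]

/-- Merging colours turns a Pólya urn into the Pólya urn with the merged masses. -/
lemma sum_urnWeight_fiber {B C : Type*} [Fintype B] [DecidableEq B] [Fintype C] [DecidableEq C]
    (α : B → ℝ) (q : B → C) {M : ℕ} (χ : Fin M → C) :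
    ∑ ψ : Fin M → B, (if q ∘ ψ = χ then urnWeight α ψ else 0) =
      urnWeight (fun c => ∑ b with q b = c, α b) χ := by
  induction M with
  | zero =>
    rw [Fintype.sum_unique, if_pos (Subsingleton.elim _ _)]
    simp [urnWeight]
  | succ M ih =>
    obtain ⟨c, χ, rfl⟩ : ∃ c χ', χ = Fin.cons c χ' := ⟨χ 0, Fin.tail χ, (Fin.cons_self_tail χ).symm⟩
    rw [urnWeight_cons, ← ih χ, mul_sum,
      ← (Fin.consEquiv fun _ : Fin (M + 1) => B).sum_comp, Fintype.sum_prod_type_right]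
    refine sum_congr rfl fun ψ _ => ?_
    have hcons : ∀ b, (q ∘ (Fin.consEquiv fun _ : Fin (M + 1) => B) (b, ψ) = Fin.cons c χ) ↔
        q b = c ∧ q ∘ ψ = χ := fun b => by
      simp [Fin.consEquiv, funext_iff, Fin.forall_fin_succ]
    simp only [hcons]
    by_cases h : q ∘ ψ = χ
    · simp only [h, and_true, if_true, ← sum_filter]
      have : ∀ b, urnWeight α ((Fin.consEquiv fun _ : Fin (M + 1) => B) (b, ψ)) =
          (α b + #{l | ψ l = b}) * urnWeight α ψ := fun b => urnWeight_cons α b ψ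
      simp only [this, ← sum_mul, sum_add_distrib]
      congr 2
      rw [← Nat.cast_sum]
      congr 1
      rw [← h, ← Finset.card_biUnion]
      · congr 1
        ext l
        simp
      · intro b _ b' _ hbb'
        exact Finset.disjoint_left.2 fun l hl hl' => hbb' (by simp_all)
    · simp [h]

lemma sum_urnWeight {B : Type*} [Fintype B] [DecidableEq B] (α : B → ℝ) (M : ℕ) :
    ∑ ψ : Fin M → B, urnWeight α ψ = ∏ j ∈ range M, (∑ b, α b + j) := by
  have h := sum_urnWeight_fiber α (fun _ => ()) (fun _ : Fin M => ())
  simp only [Subsingleton.elim (_ ∘ _) (fun _ : Fin M => ()), if_true] at h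
  rw [h]
  simp [urnWeight]

lemma sum_urnWeight_mul_comp {B C : Type*} [Fintype B] [DecidableEq B] [Fintype C]
    [DecidableEq C] (α : B → ℝ) (q : B → C) {M : ℕ} (f : (Fin M → C) → ℝ) :
    ∑ ψ : Fin M → B, urnWeight α ψ * f (q ∘ ψ) =
      ∑ χ : Fin M → C, urnWeight (fun c => ∑ b with q b = c, α b) χ * f χ := by
  simp only [← sum_urnWeight_fiber, sum_mul, ite_mul, zero_mul]
  rw [sum_comm]
  simp

lemma polyaProb_eq (κ : ℝ) {M n : ℕ} (ψ : Fin M → Fin n) :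
    polyaProb κ ψ = urnWeight (fun _ => κ) ψ / ∏ j ∈ range M, (κ * n + j) := rfl

lemma polyaProb_nonneg {κ : ℝ} (hκ : 0 ≤ κ) {M n : ℕ} (ψ : Fin M → Fin n) :
    0 ≤ polyaProb κ ψ :=
  div_nonneg (urnWeight_nonneg (fun _ => hκ) ψ) (prod_nonneg fun _ _ => by positivity)

lemma sum_polyaProb {κ : ℝ} (hκ : 0 < κ) (M : ℕ) {n : ℕ} (hn : n ≠ 0) :
    ∑ ψ : Fin M → Fin n, polyaProb κ ψ = 1 := by
  have hn' : (0 : ℝ) < n := by positivity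
  simp only [polyaProb_eq, ← sum_div, sum_urnWeight]
  rw [sum_const, Finset.card_univ, Fintype.card_fin, nsmul_eq_mul, mul_comm]
  exact div_self (prod_pos fun _ _ => by positivity).ne'

lemma measurable_gammaPDF (a r : ℝ) : Measurable (gammaPDF a r) :=
  (measurable_gammaPDFReal a r).ennreal_ofReal

lemma ae_gammaMeasure_pos (a r : ℝ) : ∀ᵐ x ∂gammaMeasure a r, 0 < x := by
  rw [gammaMeasure, ae_withDensity_iff (measurable_gammaPDF a r)]
  filter_upwards [volume.ae_ne (0 : ℝ)] with x hx h
  by_contra hx'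
  exact h (gammaPDF_of_neg (lt_of_le_of_ne (not_lt.1 hx') hx))

/-- Exponentially tilted moments of the gamma distribution. -/
lemma lintegral_pow_mul_exp_gammaMeasure {κ θ t : ℝ} (hκ : 0 < κ) (hθ : 0 < θ) (ht : 0 < t)
    (c : ℕ) :
    ∫⁻ x, ENNReal.ofReal (x ^ c * Real.exp ((θ - t) * x)) ∂gammaMeasure κ θ =
      ENNReal.ofReal (θ ^ κ / Real.Gamma κ * Real.Gamma (κ + c) / t ^ (κ + c)) := by
  have hκc : 0 < κ + c := by positivity
  rw [gammaMeasure, lintegral_withDensity_eq_lintegral_mul _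
    (measurable_gammaPDF κ θ) (by fun_prop)]
  have h : ∀ᵐ x : ℝ, (gammaPDF κ θ * fun x => ENNReal.ofReal (x ^ c * Real.exp ((θ - t) * x))) x =
      ENNReal.ofReal (θ ^ κ / Real.Gamma κ * Real.Gamma (κ + c) / t ^ (κ + c)) *
        gammaPDF (κ + c) t x := by
    filter_upwards [volume.ae_ne (0 : ℝ)] with x hx
    rcases lt_or_gt_of_ne hx with hx | hx
    · simp [gammaPDF_of_neg hx]
    · have h1 := Real.Gamma_pos_of_pos hκ
      have h2 := Real.Gamma_pos_of_pos hκc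
      rw [Pi.mul_apply, gammaPDF_of_nonneg hx.le, gammaPDF_of_nonneg hx.le,
        ← ENNReal.ofReal_mul (by positivity), ← ENNReal.ofReal_mul (by positivity)]
      congr 1
      have e1 : Real.exp (-(t * x)) = Real.exp (-(θ * x)) * Real.exp ((θ - t) * x) := by
        rw [← Real.exp_add]; ring_nf
      have e2 : x ^ (κ + c - 1) = x ^ (κ - 1) * x ^ c := by
        rw [← Real.rpow_natCast, ← Real.rpow_add hx]; ring_nf
      have h3 : 0 < t ^ (κ + c) := by positivity
      rw [e1, e2]
      field_simp
  rw [lintegral_congr_ae h, lintegral_const_mul _ (measurable_gammaPDF _ _),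
    lintegral_gammaPDF_eq_one hκc ht, mul_one]

lemma integrable_of_lintegral_eq_ofReal {α : Type*} [MeasurableSpace α] {μ : Measure α}
    {f : α → ℝ} (hf : Measurable f) (h0 : 0 ≤ᵐ[μ] f) {a : ℝ}
    (h : ∫⁻ x, ENNReal.ofReal (f x) ∂μ = ENNReal.ofReal a) : Integrable f μ :=
  ⟨hf.aestronglyMeasurable, (hasFiniteIntegral_iff_ofReal h0).2 (h ▸ ENNReal.ofReal_lt_top)⟩

lemma integral_of_lintegral_eq_ofReal {α : Type*} [MeasurableSpace α] {μ : Measure α}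
    {f : α → ℝ} (hf : Measurable f) (h0 : 0 ≤ᵐ[μ] f) {a : ℝ} (ha : 0 ≤ a)
    (h : ∫⁻ x, ENNReal.ofReal (f x) ∂μ = ENNReal.ofReal a) : ∫ x, f x ∂μ = a := by
  rw [integral_eq_lintegral_of_nonneg_ae h0 hf.aestronglyMeasurable, h, ENNReal.toReal_ofReal ha]

lemma lintegral_rpow_mul_exp_neg {a b : ℝ} (ha : 0 < a) (hb : 0 < b) :
    ∫⁻ s in Set.Ioi 0, ENNReal.ofReal (s ^ (a - 1) * Real.exp (-(b * s))) =
      ENNReal.ofReal (Real.Gamma a / b ^ a) := by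
  have hG := Real.Gamma_pos_of_pos ha
  have h := Real.integral_rpow_mul_exp_neg_mul_Ioi ha hb
  rw [Real.div_rpow zero_le_one hb.le, Real.one_rpow, div_mul_eq_mul_div, one_mul] at h
  rw [← h, ofReal_integral_eq_lintegral_ofReal]
  · refine Integrable.of_integral_ne_zero ?_
    rw [h]
    positivity
  · filter_upwards [ae_restrict_mem measurableSet_Ioi] with s hs
    have : (0 : ℝ) < s := hs
    positivity

section GammaProduct

variable {V : Type*} [Fintype V]

/-- The law of independent `Gamma(κ, θ)` variables indexed by `V`. -/
noncomputable abbrev gammaPi (V : Type*) [Fintype V] (κ θ : ℝ) : Measure (V → ℝ) :=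
  Measure.pi fun _ : V => gammaMeasure κ θ

lemma ae_gammaPi_pos {κ θ : ℝ} (hκ : 0 < κ) (hθ : 0 < θ) :
    ∀ᵐ x ∂gammaPi V κ θ, ∀ v, 0 < x v := by
  have := isProbabilityMeasure_gammaMeasure hκ hθ
  rw [ae_all_iff]
  exact fun v => (measurePreserving_eval (fun _ : V => gammaMeasure κ θ) v).quasiMeasurePreserving.ae
    (ae_gammaMeasure_pos κ θ)

lemma lintegral_prod_gammaPi {κ θ : ℝ} (hκ : 0 < κ) (hθ : 0 < θ) {t : ℝ} (ht : 0 < t)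
    (c : V → ℕ) :
    ∫⁻ x, ENNReal.ofReal (∏ v, (x v ^ c v * Real.exp ((θ - t) * x v))) ∂gammaPi V κ θ =
      ENNReal.ofReal (∏ v, (θ ^ κ / Real.Gamma κ * Real.Gamma (κ + c v) / t ^ (κ + c v))) := by
  have := isProbabilityMeasure_gammaMeasure hκ hθ
  have h0 : ∀ v, 0 ≤ᵐ[gammaMeasure κ θ] fun x => x ^ c v * Real.exp ((θ - t) * x) := fun v => by
    filter_upwards [ae_gammaMeasure_pos κ θ] with x hx
    positivity
  have hG := Real.Gamma_pos_of_pos hκ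
  have hGc : ∀ v, 0 < Real.Gamma (κ + c v) := fun v => Real.Gamma_pos_of_pos (by positivity)
  have h1 := fun v => lintegral_pow_mul_exp_gammaMeasure hκ hθ ht (c v)
  have h2 := fun v => integrable_of_lintegral_eq_ofReal (by fun_prop) (h0 v) (h1 v)
  have h3 := fun v => integral_of_lintegral_eq_ofReal (by fun_prop) (h0 v)
    (by have := hGc v; positivity) (h1 v)
  rw [← ofReal_integral_eq_lintegral_ofReal (Integrable.fintype_prod h2),
    integral_fintype_prod_eq_prod (𝕜 := ℝ) (fun v y => y ^ c v * Real.exp ((θ - t) * y))]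
  · simp only [h3]
  · filter_upwards [ae_gammaPi_pos hκ hθ] with x hx
    exact prod_nonneg fun v _ => by have := hx v; positivity

/-- The inverted Dirichlet integral, relative to the product of gamma distributions. -/
lemma lintegral_inverted_dirichlet {κ θ r B : ℝ} (hκ : 0 < κ) (hθ : 0 < θ) (hr : 0 < r)
    (c : V → ℕ) (hB : ∑ v, (κ + c v) < B) :
    ∫⁻ x, ENNReal.ofReal ((∏ v, x v ^ c v) *
        (Real.exp (θ * ∑ v, x v) * (1 + (∑ v, x v) / r) ^ (-B))) ∂gammaPi V κ θ =
      ENNReal.ofReal ((∏ v, (θ ^ κ / Real.Gamma κ * Real.Gamma (κ + c v))) *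
        r ^ (∑ v, (κ + c v)) * Real.Gamma (B - ∑ v, (κ + c v)) / Real.Gamma B) := by
  have := isProbabilityMeasure_gammaMeasure hκ hθ
  set A := ∑ v, (κ + c v) with hA
  have hA0 : 0 ≤ A := sum_nonneg fun v _ => by positivity
  have hB0 : 0 < B := hA0.trans_lt hB
  have hGB := Real.Gamma_pos_of_pos hB0
  have hG := Real.Gamma_pos_of_pos hκ
  have hGc : ∀ v, 0 < Real.Gamma (κ + c v) := fun v => Real.Gamma_pos_of_pos (by positivity)
  set D := ∏ v, (θ ^ κ / Real.Gamma κ * Real.Gamma (κ + c v)) with hD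
  have hD0 : 0 ≤ D := prod_nonneg fun v _ => by have := hGc v; positivity
  have key : ∀ᵐ x ∂gammaPi V κ θ, ENNReal.ofReal ((∏ v, x v ^ c v) *
        (Real.exp (θ * ∑ v, x v) * (1 + (∑ v, x v) / r) ^ (-B))) =
      ENNReal.ofReal (Real.Gamma B)⁻¹ * ∫⁻ s in Set.Ioi (0 : ℝ),
        ENNReal.ofReal (s ^ (B - 1) * Real.exp (-s)) *
          ENNReal.ofReal (∏ v, (x v ^ c v * Real.exp ((θ - s / r) * x v))) := by
    filter_upwards [ae_gammaPi_pos hκ hθ] with x hx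
    have hS : 0 ≤ ∑ v, x v := sum_nonneg fun v _ => (hx v).le
    have hP : 0 ≤ ∏ v, x v ^ c v := prod_nonneg fun v _ => pow_nonneg (hx v).le _
    have h1 : 0 < 1 + (∑ v, x v) / r := by positivity
    have e : ∀ s : ℝ, ENNReal.ofReal (s ^ (B - 1) * Real.exp (-s)) *
          ENNReal.ofReal (∏ v, (x v ^ c v * Real.exp ((θ - s / r) * x v))) =
        ENNReal.ofReal ((∏ v, x v ^ c v) * Real.exp (θ * ∑ v, x v)) *
          ENNReal.ofReal (s ^ (B - 1) * Real.exp (-((1 + (∑ v, x v) / r) * s))) := fun s => by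
      rw [← ENNReal.ofReal_mul' (prod_nonneg fun v _ => by have := hx v; positivity),
        ← ENNReal.ofReal_mul (by positivity)]
      congr 1
      rw [prod_mul_distrib, ← Real.exp_sum, ← mul_sum]
      have : Real.exp (-s) * Real.exp ((θ - s / r) * ∑ v, x v) =
          Real.exp (θ * ∑ v, x v) * Real.exp (-((1 + (∑ v, x v) / r) * s)) := by
        rw [← Real.exp_add, ← Real.exp_add]
        congr 1
        field_simp
        ring
      linear_combination (s ^ (B - 1) * ∏ v, x v ^ c v) * this
    simp only [e]
    rw [lintegral_const_mul _ (by fun_prop), lintegral_rpow_mul_exp_neg hB0 h1,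
      ← ENNReal.ofReal_mul (by positivity), ← ENNReal.ofReal_mul (by positivity),
      Real.rpow_neg h1.le]
    congr 1
    field_simp
  rw [lintegral_congr_ae key, lintegral_const_mul _ (by fun_prop), lintegral_lintegral_swap
    (by fun_prop)]
  have inner : ∀ s ∈ Set.Ioi (0 : ℝ), ∫⁻ x, ENNReal.ofReal (s ^ (B - 1) * Real.exp (-s)) *
          ENNReal.ofReal (∏ v, (x v ^ c v * Real.exp ((θ - s / r) * x v))) ∂gammaPi V κ θ =
      ENNReal.ofReal (D * r ^ A) * ENNReal.ofReal (s ^ (B - A - 1) * Real.exp (-(1 * s))) := by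
    intro s (hs : 0 < s)
    rw [lintegral_const_mul _ (by fun_prop), lintegral_prod_gammaPi hκ hθ (div_pos hs hr),
      ← ENNReal.ofReal_mul (by positivity), ← ENNReal.ofReal_mul (by positivity)]
    congr 1
    rw [prod_div_distrib, ← hD]
    have : ∏ v, (s / r) ^ (κ + c v) = (s / r) ^ A := by
      rw [hA, Real.rpow_sum_of_pos (div_pos hs hr)]
    have e3 : s ^ (B - A - 1) = s ^ (B - 1) / s ^ A := by
      rw [← Real.rpow_sub hs]; ring_nf
    have := Real.rpow_pos_of_pos hs A
    have := Real.rpow_pos_of_pos hr A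
    rw [‹∏ v, (s / r) ^ (κ + c v) = (s / r) ^ A›, Real.div_rpow hs.le hr.le, e3, one_mul]
    field_simp
  rw [setLIntegral_congr_fun measurableSet_Ioi inner, lintegral_const_mul _ (by fun_prop),
    lintegral_rpow_mul_exp_neg (sub_pos.2 hB) one_pos, ← ENNReal.ofReal_mul (by positivity),
    ← ENNReal.ofReal_mul (by positivity)]
  congr 1
  rw [Real.one_rpow]
  field_simp

end GammaProduct

lemma Gamma_add_natCast {a : ℝ} (ha : 0 < a) (c : ℕ) :
    Real.Gamma (a + c) = Real.Gamma a * ∏ j ∈ range c, (a + j) := by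
  induction c with
  | zero => simp
  | succ c ih =>
    rw [Nat.cast_succ, ← add_assoc, Real.Gamma_add_one (by positivity), ih, prod_range_succ]
    ring

lemma prod_comp_eq_prod_pow {C R : Type*} [Fintype C] [DecidableEq C] [CommMonoid R] {M : ℕ}
    (f : C → R) (χ : Fin M → C) : ∏ l, f (χ l) = ∏ c, f c ^ #{l | χ l = c} := by
  rw [← Finset.prod_fiberwise univ χ]
  refine prod_congr rfl fun c _ => ?_
  rw [prod_congr rfl (g := fun _ => f c) fun l hl => by rw [(mem_filter.1 hl).2], prod_const]

section Mixture

variable {V : Type*} [Fintype V]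

/-- The inverted Dirichlet density relative to the product of `Gamma(κ, θ)` distributions, up to
normalisation. -/
noncomputable def mixDensity (θ r B : ℝ) (x : V → ℝ) : ℝ :=
  Real.exp (θ * ∑ v, x v) * (1 + (∑ v, x v) / r) ^ (-B)

/-- The colour probabilities with `V` distinguished colours of relative mass `x` and
one remaining colour of relative mass `r`. -/
noncomputable def mixProb (r : ℝ) (x : V → ℝ) (o : Option V) : ℝ :=
  o.elim 1 (fun v => x v / r) / (1 + (∑ v, x v) / r)

lemma measurable_mixDensity (θ r B : ℝ) : Measurable (mixDensity (V := V) θ r B) := by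
  unfold mixDensity; fun_prop

lemma measurable_mixProb (r : ℝ) (o : Option V) :
    Measurable fun x : V → ℝ => mixProb r x o := by
  unfold mixProb
  cases o <;> simp only [Option.elim] <;> fun_prop

lemma mixDensity_pos {θ r B : ℝ} (hr : 0 < r) {x : V → ℝ} (hx : ∀ v, 0 < x v) :
    0 < mixDensity θ r B x := by
  have hS : 0 ≤ ∑ v, x v := sum_nonneg fun v _ => (hx v).le
  unfold mixDensity
  positivity

lemma mixProb_nonneg {r : ℝ} (hr : 0 < r) {x : V → ℝ} (hx : ∀ v, 0 < x v) (o : Option V) :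
    0 ≤ mixProb r x o := by
  have hS : 0 ≤ ∑ v, x v := sum_nonneg fun v _ => (hx v).le
  unfold mixProb
  cases o with
  | none => simp only [Option.elim]; positivity
  | some v => have := hx v; simp only [Option.elim]; positivity

lemma sum_mixProb {r : ℝ} (hr : 0 < r) {x : V → ℝ} (hx : ∀ v, 0 < x v) :
    ∑ o, mixProb r x o = 1 := by
  have hS : 0 ≤ ∑ v, x v := sum_nonneg fun v _ => (hx v).le
  have h1 : 0 < 1 + (∑ v, x v) / r := by positivity
  simp only [mixProb, ← sum_div, Fintype.sum_option, Option.elim]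
  exact div_self h1.ne'

variable {κ θ r B : ℝ}

lemma integrable_mixDensity (hκ : 0 < κ) (hθ : 0 < θ) (hr : 0 < r)
    (hB : κ * Fintype.card V < B) : Integrable (mixDensity θ r B) (gammaPi V κ θ) := by
  have h0 : 0 ≤ᵐ[gammaPi V κ θ] mixDensity θ r B := by
    filter_upwards [ae_gammaPi_pos hκ hθ] with x hx
    exact (mixDensity_pos hr hx).le
  have h := lintegral_inverted_dirichlet (V := V) hκ hθ hr (fun _ => 0) (B := B)
    (by simpa [mul_comm] using hB)
  simp only [pow_zero, prod_const_one, one_mul] at h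
  exact integrable_of_lintegral_eq_ofReal (measurable_mixDensity θ r B) h0 h

lemma integral_mixDensity (hκ : 0 < κ) (hθ : 0 < θ) (hr : 0 < r)
    (hB : κ * Fintype.card V < B) :
    ∫ x, mixDensity θ r B x ∂gammaPi V κ θ = (θ ^ κ) ^ Fintype.card V *
      r ^ (κ * Fintype.card V) * Real.Gamma (B - κ * Fintype.card V) / Real.Gamma B := by
  have hG := Real.Gamma_pos_of_pos hκ
  have hB0 : 0 < B := lt_of_le_of_lt (by positivity) hB
  have hGB := Real.Gamma_pos_of_pos hB0
  have hGB' := Real.Gamma_pos_of_pos (sub_pos.2 hB)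
  refine integral_of_lintegral_eq_ofReal (measurable_mixDensity θ r B) ?_ (by positivity)
    ?_
  · filter_upwards [ae_gammaPi_pos hκ hθ] with x hx
    exact (mixDensity_pos hr hx).le
  · have := lintegral_inverted_dirichlet (V := V) hκ hθ hr (fun _ => 0)
      (by simpa [mul_comm] using hB)
    simpa [mixDensity, mul_comm _ κ, div_mul_cancel₀ _ hG.ne'] using this

lemma mixDensity_tendsto (κ ρ : ℝ) (x : V → ℝ) :
    Tendsto (fun n : ℕ => mixDensity (κ / ρ) (ρ * n) (κ * n) x) atTop (nhds 1) := by
  have h1 := Real.tendsto_one_add_div_pow_exp ((∑ v, x v) / ρ)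
  have h2 := (h1.rpow_const (p := -κ) (Or.inl (Real.exp_pos _).ne')).const_mul
    (Real.exp (κ / ρ * ∑ v, x v))
  rw [← Real.exp_mul, ← Real.exp_add,
    show κ / ρ * ∑ v, x v + (∑ v, x v) / ρ * -κ = 0 by ring, Real.exp_zero] at h2
  refine h2.congr' ?_
  obtain ⟨N, hN⟩ := exists_nat_gt (-((∑ v, x v) / ρ))
  filter_upwards [eventually_ge_atTop N, eventually_gt_atTop 0] with n hn hn0
  have hn0' : (0 : ℝ) < n := by exact_mod_cast hn0
  have hn' : (N : ℝ) ≤ n := by exact_mod_cast hn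
  have hb : 0 ≤ 1 + (∑ v, x v) / ρ / n := by
    have : 0 ≤ (n + (∑ v, x v) / ρ) / n := div_nonneg (by linarith) hn0'.le
    rwa [add_div, div_self hn0'.ne'] at this
  rw [mixDensity, ← Real.rpow_natCast, ← Real.rpow_mul hb, div_div]
  congr 2
  ring

lemma one_add_div_pow_le {y : ℝ} (hy : 0 ≤ y) {N n : ℕ} (hN : 0 < N) (hNn : N ≤ n) :
    (1 + y / N) ^ N ≤ (1 + y / n) ^ n := by
  have hN' : (0 : ℝ) < N := by exact_mod_cast hN
  have hn' : (0 : ℝ) < n := by exact_mod_cast hN.trans_le hNn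
  have h := one_add_mul_self_le_rpow_one_add (s := y / n) (p := n / N)
    (by have : 0 ≤ y / n := by positivity
        linarith) ((one_le_div hN').2 (by exact_mod_cast hNn))
  have h' : 1 + y / N ≤ (1 + y / n) ^ ((n : ℝ) / N) := by
    convert h using 2
    field_simp
  calc (1 + y / N) ^ N ≤ ((1 + y / n) ^ ((n : ℝ) / N)) ^ N := by gcongr
    _ = (1 + y / n) ^ n := by
      rw [← Real.rpow_natCast, ← Real.rpow_mul (by positivity), div_mul_cancel₀ _ hN'.ne',
        Real.rpow_natCast]

lemma mixDensity_le {κ ρ : ℝ} (hκ : 0 < κ) (hρ : 0 < ρ) {x : V → ℝ} (hx : ∀ v, 0 < x v) {N n : ℕ}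
    (hN : 0 < N) (hNn : N ≤ n) :
    mixDensity (κ / ρ) (ρ * n) (κ * n) x ≤ mixDensity (κ / ρ) (ρ * N) (κ * N) x := by
  have hS : 0 ≤ ∑ v, x v := sum_nonneg fun v _ => (hx v).le
  have e : ∀ k : ℕ, (1 + (∑ v, x v) / (ρ * k)) ^ (-(κ * k)) =
      ((1 + (∑ v, x v) / ρ / k) ^ k) ^ (-κ) := fun k => by
    rw [← Real.rpow_natCast, ← Real.rpow_mul (by positivity), div_div]
    congr 1
    ring
  unfold mixDensity
  rw [e, e]
  gcongr ?_ * ?_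
  exact Real.rpow_le_rpow_of_nonpos (by positivity) (one_add_div_pow_le (by positivity) hN hNn)
    (by linarith)

variable [DecidableEq V]

lemma mixDensity_mul_prod {r B : ℝ} (hr : 0 < r) {M : ℕ} (χ : Fin M → Option V) {x : V → ℝ}
    (hx : ∀ v, 0 < x v) :
    mixDensity θ r B x * ∏ l, mixProb r x (χ l) =
      (r ^ (∑ v, #{l | χ l = some v}))⁻¹ * ((∏ v, x v ^ #{l | χ l = some v}) *
        (Real.exp (θ * ∑ v, x v) * (1 + (∑ v, x v) / r) ^ (-(B + M)))) := by
  have hS : 0 ≤ ∑ v, x v := sum_nonneg fun v _ => (hx v).le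
  have h1 : 0 < 1 + (∑ v, x v) / r := by positivity
  have h2 : (1 + (∑ v, x v) / r) ^ (-(B + M)) =
      (1 + (∑ v, x v) / r) ^ (-B) * ((1 + (∑ v, x v) / r) ^ M)⁻¹ := by
    rw [neg_add, Real.rpow_add h1, Real.rpow_neg h1.le M, Real.rpow_natCast]
  simp only [mixProb, prod_div_distrib, prod_const, Finset.card_univ, Fintype.card_fin]
  rw [prod_comp_eq_prod_pow (fun o : Option V => o.elim 1 fun v => x v / r), Fintype.prod_option,
    h2, mixDensity]
  simp only [Option.elim, one_pow, one_mul, div_pow, prod_div_distrib, prod_pow_eq_pow_sum]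
  ring

/-- De Finetti representation of the merged Pólya urn. -/
lemma integral_mixDensity_mul_prod (hκ : 0 < κ) (hθ : 0 < θ) (hr : 0 < r)
    (hB : κ * Fintype.card V < B) {M : ℕ} (χ : Fin M → Option V) :
    Integrable (fun x => mixDensity θ r B x * ∏ l, mixProb r x (χ l)) (gammaPi V κ θ) ∧
    ∫ x, mixDensity θ r B x * ∏ l, mixProb r x (χ l) ∂gammaPi V κ θ =
      (∫ x, mixDensity θ r B x ∂gammaPi V κ θ) *
        (urnWeight (fun o : Option V => o.elim (B - κ * Fintype.card V) fun _ => κ) χ /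
          ∏ j ∈ range M, (B + j)) := by
  set c : V → ℕ := fun v => #{l | χ l = some v} with hc
  have hM : #{l | χ l = none} + ∑ v, c v = M := by
    have := Finset.card_eq_sum_card_fiberwise (f := χ) (s := univ) (t := univ) (by simp)
    rw [Fintype.sum_option, Finset.card_univ, Fintype.card_fin] at this
    exact this.symm
  have hMr : (#{l | χ l = none} : ℝ) + ∑ v, (c v : ℝ) = M := by exact_mod_cast hM
  have hA : ∑ v, (κ + c v) = κ * Fintype.card V + ∑ v, (c v : ℝ) := by
    simp [sum_add_distrib, mul_comm]
  have hA' : ∑ v, (κ + c v) < B + M := by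
    rw [hA, ← hMr]
    have : (0 : ℝ) ≤ #{l | χ l = none} := by positivity
    linarith
  have hG := Real.Gamma_pos_of_pos hκ
  have hB0 : 0 < B := lt_of_le_of_lt (by positivity) hB
  have hGB := Real.Gamma_pos_of_pos hB0
  have hBK := sub_pos.2 hB
  have hGB' := Real.Gamma_pos_of_pos hBK
  have hL := lintegral_inverted_dirichlet (V := V) hκ hθ hr c hA'
  have hmeas : Measurable fun x : V → ℝ => (∏ v, x v ^ c v) *
      (Real.exp (θ * ∑ v, x v) * (1 + (∑ v, x v) / r) ^ (-(B + M))) := by fun_prop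
  have h0 : 0 ≤ᵐ[gammaPi V κ θ] fun x : V → ℝ => (∏ v, x v ^ c v) *
      (Real.exp (θ * ∑ v, x v) * (1 + (∑ v, x v) / r) ^ (-(B + M))) := by
    filter_upwards [ae_gammaPi_pos hκ hθ] with x hx
    have hS : 0 ≤ ∑ v, x v := sum_nonneg fun v _ => (hx v).le
    have hP : 0 ≤ ∏ v, x v ^ c v := prod_nonneg fun v _ => pow_nonneg (hx v).le _
    simp only [Pi.zero_apply]
    positivity
  have heq : (fun x => mixDensity θ r B x * ∏ l, mixProb r x (χ l)) =ᵐ[gammaPi V κ θ]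
      fun x => (r ^ (∑ v, c v))⁻¹ * ((∏ v, x v ^ c v) *
        (Real.exp (θ * ∑ v, x v) * (1 + (∑ v, x v) / r) ^ (-(B + M)))) := by
    filter_upwards [ae_gammaPi_pos hκ hθ] with x hx
    exact mixDensity_mul_prod hr χ hx
  have h_int := integrable_of_lintegral_eq_ofReal hmeas h0 hL
  refine ⟨(h_int.const_mul _).congr heq.symm, ?_⟩
  have hGBM := Real.Gamma_pos_of_pos (s := B + M) (by positivity)
  have hGA := Real.Gamma_pos_of_pos (sub_pos.2 hA')
  have hval := integral_of_lintegral_eq_ofReal hmeas h0 (a := _) (mul_nonneg (mul_nonneg (mul_nonneg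
    (prod_nonneg fun v _ => by
      have := Real.Gamma_pos_of_pos (s := κ + c v) (by positivity)
      positivity) (by positivity)) hGA.le) (inv_nonneg.2 hGBM.le)) hL
  rw [integral_congr_ae heq, integral_const_mul, hval, integral_mixDensity hκ hθ hr hB]
  have e1 : Real.Gamma (B + M - ∑ v, (κ + c v)) = Real.Gamma (B - κ * Fintype.card V) *
      ∏ j ∈ range #{l | χ l = none}, (B - κ * Fintype.card V + j) := by
    rw [← Gamma_add_natCast hBK, hA, ← hMr]
    congr 1
    ring
  have e2 : ∏ v, (θ ^ κ / Real.Gamma κ * Real.Gamma (κ + c v)) =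
      (θ ^ κ) ^ Fintype.card V * ∏ v, ∏ j ∈ range (c v), (κ + j) := by
    rw [← Finset.card_univ, ← prod_const, ← prod_mul_distrib]
    refine prod_congr rfl fun v _ => ?_
    rw [Gamma_add_natCast hκ]
    field_simp
  have e3 : r ^ (∑ v, (κ + c v)) = r ^ (κ * Fintype.card V) * r ^ (∑ v, c v) := by
    rw [hA, Real.rpow_add hr, ← Nat.cast_sum, Real.rpow_natCast]
  rw [e1, e2, e3, Gamma_add_natCast hB0, urnWeight, Fintype.prod_option]
  simp only [Option.elim]
  have : 0 < ∏ j ∈ range M, (B + j) := prod_pos fun _ _ => by positivity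
  have := pow_pos hr (∑ v, c v)
  field_simp
  rfl

end Mixture

lemma coeff_sum_C_mul_X_add_C_pow {τ : Type*} [Fintype τ] (q : τ → ℝ) (q0 : ℝ) (a : τ → ℕ)
    (m : ℕ) :
    MvPolynomial.coeff (Finsupp.equivFunOnFinite.symm a)
      ((∑ t, MvPolynomial.C (q t) * MvPolynomial.X t + MvPolynomial.C q0) ^ m) =
      m.choose (∑ t, a t) * q0 ^ (m - ∑ t, a t) * (Nat.multinomial univ a * ∏ t, q t ^ a t) := by
  classical
  rw [add_pow, MvPolynomial.coeff_sum]
  have hk : ∀ k, MvPolynomial.coeff (Finsupp.equivFunOnFinite.symm a)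
      ((∑ t, MvPolynomial.C (q t) * MvPolynomial.X t) ^ k * MvPolynomial.C q0 ^ (m - k) *
        (m.choose k : MvPolynomial τ ℝ)) =
      if k = ∑ t, a t then m.choose (∑ t, a t) * q0 ^ (m - ∑ t, a t) *
        (Nat.multinomial univ a * ∏ t, q t ^ a t) else 0 := by
    intro k
    rw [← map_pow, ← MvPolynomial.C_eq_coe_nat, mul_assoc, ← MvPolynomial.C_mul, mul_comm,
      MvPolynomial.coeff_C_mul, Finset.sum_pow_eq_sum_piAntidiag, MvPolynomial.coeff_sum]
    have hf : ∀ f : τ → ℕ, MvPolynomial.coeff (Finsupp.equivFunOnFinite.symm a)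
        ((Nat.multinomial univ f : MvPolynomial τ ℝ) *
          ∏ t, (MvPolynomial.C (q t) * MvPolynomial.X t) ^ f t) =
        if f = a then Nat.multinomial univ a * ∏ t, q t ^ a t else 0 := by
      intro f
      have hind : (Finsupp.indicator univ fun i _ => f i) = Finsupp.equivFunOnFinite.symm f := by
        ext; simp
      simp only [mul_pow, prod_mul_distrib, ← map_pow, ← map_prod, ← MvPolynomial.C_eq_coe_nat,
        MvPolynomial.coeff_C_mul, MvPolynomial.coeff_prod_X_pow, hind]
      by_cases h : f = a
      · subst h; simp
      · rw [if_neg h, if_neg fun h' => h (Finsupp.equivFunOnFinite.symm.injective h').symm]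
        simp
    simp only [hf, sum_ite_eq', mem_piAntidiag, mem_univ, implies_true, and_true]
    by_cases h : k = ∑ t, a t
    · rw [if_pos h, if_pos h.symm, h]
      ring
    · rw [if_neg h, if_neg fun h' => h h'.symm, mul_zero]
  rw [sum_congr rfl fun k _ => hk k, sum_ite_eq']
  split_ifs with h
  · rfl
  · rw [Nat.choose_eq_zero_of_lt (by simpa [Nat.succ_le_iff] using h)]
    simp

/-- The multinomial law: the probability that `m` independent trials with cell masses
determined by `w` and the classification `c` hit each cell `t` exactly `a t` times. -/
lemma sum_count_eq_multinomial {D τ : Type*} [Fintype D] [Fintype τ] [DecidableEq τ]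
    (c : D → Option τ) (w : D → ℝ) (a : τ → ℕ) (m : ℕ) :
    ∑ e : Fin m → D, (if ∀ t, #{l | c (e l) = some t} = a t then ∏ l, w (e l) else 0) =
      m.choose (∑ t, a t) * (∑ d with c d = none, w d) ^ (m - ∑ t, a t) *
        (Nat.multinomial univ a * ∏ t, (∑ d with c d = some t, w d) ^ a t) := by
  classical
  let mon : Option τ → (τ →₀ ℕ) := fun o => o.elim 0 fun t => Finsupp.single t 1
  have hP : ∑ d, MvPolynomial.monomial (mon (c d)) (w d) =
      ∑ t, MvPolynomial.C (∑ d with c d = some t, w d) * MvPolynomial.X t +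
        MvPolynomial.C (∑ d with c d = none, w d) := by
    rw [← Finset.sum_fiberwise univ c, Fintype.sum_option, add_comm]
    congr 1
    · refine sum_congr rfl fun t _ => ?_
      rw [map_sum, sum_mul]
      refine sum_congr rfl fun d hd => ?_
      rw [(mem_filter.1 hd).2, MvPolynomial.C_mul_X_eq_monomial]
      rfl
    · rw [map_sum]
      refine sum_congr rfl fun d hd => ?_
      rw [(mem_filter.1 hd).2]
      rfl
  rw [← coeff_sum_C_mul_X_add_C_pow, ← hP, Fintype.sum_pow, MvPolynomial.coeff_sum]
  refine sum_congr rfl fun e _ => ?_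
  rw [← MvPolynomial.monomial_sum_prod, MvPolynomial.coeff_monomial]
  refine if_congr ?_ rfl rfl
  rw [Finsupp.ext_iff]
  refine forall_congr' fun t => ?_
  rw [Finsupp.finsetSum_apply, Finset.card_filter]
  have : ∀ l, mon (c (e l)) t = if c (e l) = some t then 1 else 0 := fun l => by
    rcases c (e l) with _ | t' <;> simp [mon, Finsupp.single_apply]
  simp only [this, Finsupp.equivFunOnFinite_symm_apply_apply]

/-- If `m i * u i → t` and `m i → ∞` then `(1 + u i) ^ m i → exp t`. -/
lemma tendsto_one_add_pow_exp {ι : Type*} {l : Filter ι} {m : ι → ℕ} {u : ι → ℝ} {t : ℝ}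
    (hm : Tendsto m l atTop) (hu : Tendsto (fun i => m i * u i) l (nhds t)) :
    Tendsto (fun i => (1 + u i) ^ m i) l (nhds (Real.exp t)) := by
  have hm' : Tendsto (fun i => (m i : ℝ)) l atTop := tendsto_natCast_atTop_atTop.comp hm
  have hu0 : Tendsto u l (nhds 0) := by
    have := hu.mul (tendsto_inv_atTop_zero.comp hm')
    rw [mul_zero] at this
    refine this.congr' ?_
    filter_upwards [hm'.eventually_gt_atTop 0] with i hi
    simp only [Function.comp]
    field_simp
  have hd : HasDerivAt (fun y : ℝ => Real.log (1 + y)) 1 0 := by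
    have := ((hasDerivAt_id (0 : ℝ)).const_add 1).log (by simp)
    simpa using this
  have hs : Tendsto (dslope (fun y : ℝ => Real.log (1 + y)) 0) (nhds 0) (nhds 1) := by
    have := (continuousAt_dslope_same.2 hd.differentiableAt).tendsto
    rwa [dslope_same, hd.deriv] at this
  have h1 := hu.mul (hs.comp hu0)
  rw [mul_one] at h1
  refine ((Real.continuous_exp.tendsto t).comp h1).congr' ?_
  filter_upwards [hu0.eventually (lt_mem_nhds (show (-1 : ℝ) < 0 by norm_num))] with i hi
  have h2 : u i * dslope (fun y : ℝ => Real.log (1 + y)) 0 (u i) = Real.log (1 + u i) := by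
    have := sub_smul_dslope (fun y : ℝ => Real.log (1 + y)) 0 (u i)
    simpa using this
  simp only [Function.comp]
  rw [mul_assoc, h2, Real.exp_nat_mul, Real.exp_log (by linarith)]

/-- Multinomial probabilities with vanishing cell probabilities are asymptotically products of
Poisson weights. -/
lemma tendsto_multinomial_poisson {ι τ : Type*} [Fintype τ] {l : Filter ι} {m : ι → ℕ}
    {q : ι → τ → ℝ} {lam : τ → ℝ} (hm : Tendsto m l atTop)
    (hq : ∀ t, Tendsto (fun i => m i * q i t) l (nhds (lam t))) (a : τ → ℕ) :
    Tendsto (fun i => ((m i).choose (∑ t, a t) : ℝ) * (1 - ∑ t, q i t) ^ (m i - ∑ t, a t) *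
        (Nat.multinomial univ a * ∏ t, q i t ^ a t)) l
      (nhds (∏ t, poissonWeight (a t) (lam t))) := by
  set s := ∑ t, a t with hs
  have hm' : Tendsto (fun i => (m i : ℝ)) l atTop := tendsto_natCast_atTop_atTop.comp hm
  have hsum : Tendsto (fun i => (m i : ℝ) * -∑ t, q i t) l (nhds (-∑ t, lam t)) := by
    simp only [mul_neg, mul_sum]
    exact (tendsto_finsetSum _ fun t _ => hq t).neg
  have hsum0 : Tendsto (fun i => 1 - ∑ t, q i t) l (nhds 1) := by
    have := hsum.mul (tendsto_inv_atTop_zero.comp hm')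
    rw [mul_zero] at this
    have h2 := this.const_add 1
    rw [add_zero] at h2
    refine h2.congr' ?_
    filter_upwards [hm'.eventually_gt_atTop 0] with i hi
    simp only [Function.comp]
    field_simp
    ring
  have hexp := tendsto_one_add_pow_exp hm hsum
  have hpow : Tendsto (fun i => (1 - ∑ t, q i t) ^ (m i - s)) l (nhds (Real.exp (-∑ t, lam t))) := by
    have h := hexp.mul ((hsum0.pow s).inv₀ (by simp))
    rw [one_pow, inv_one, mul_one] at h
    refine h.congr' ?_
    filter_upwards [hm.eventually_ge_atTop s, hsum0.eventually_ne one_ne_zero] with i hi hne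
    rw [pow_sub₀ _ hne hi, sub_eq_add_neg]
  have hdesc : Tendsto (fun i => ((m i).descFactorial s : ℝ) / (m i : ℝ) ^ s) l (nhds 1) := by
    have h := (isEquivalent_descFactorial s)
    have h' := (Asymptotics.isEquivalent_iff_tendsto_one
      (by filter_upwards [eventually_gt_atTop 0] with n hn
          positivity)).1 h
    exact h'.comp hm
  have hprod : Tendsto (fun i => ∏ t, (m i * q i t) ^ a t) l (nhds (∏ t, lam t ^ a t)) :=
    tendsto_finsetProd _ fun t _ => (hq t).pow _
  have hall := ((hdesc.mul hpow).mul hprod).div_const (∏ t, ((a t)! : ℝ))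
  have hlim : 1 * Real.exp (-∑ t, lam t) * (∏ t, lam t ^ a t) / ∏ t, ((a t)! : ℝ) =
      ∏ t, poissonWeight (a t) (lam t) := by
    simp only [poissonWeight, prod_div_distrib, prod_mul_distrib, ← Real.exp_sum, sum_neg_distrib,
      one_mul]
  rw [hlim] at hall
  refine hall.congr' ?_
  filter_upwards [hm'.eventually_gt_atTop 0] with i hi
  have hf : 0 < ∏ t, ((a t)! : ℝ) := prod_pos fun t _ => by positivity
  have hmult : (∏ t, ((a t)! : ℝ)) * Nat.multinomial univ a = (s ! : ℝ) := by
    exact_mod_cast Nat.multinomial_spec univ a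
  have hd : ((m i).descFactorial s : ℝ) = s ! * (m i).choose s := by
    exact_mod_cast Nat.descFactorial_eq_factorial_mul_choose _ _
  have hmp : ∏ t, ((m i : ℝ) * q i t) ^ a t = (m i : ℝ) ^ s * ∏ t, q i t ^ a t := by
    simp only [mul_pow, prod_mul_distrib, prod_pow_eq_pow_sum, hs]
  rw [hd, ← hmult, hmp]
  field_simp

section Pairing

variable {C V τ : Type*}

/-- The pair of colours of the `e`-th edge. -/
def stubPair {m : ℕ} (ψ : Fin (2 * m) → C) (e : Fin m) : C × C :=
  (ψ ⟨2 * (e : ℕ), by have := e.isLt; omega⟩, ψ ⟨2 * (e : ℕ) + 1, by have := e.isLt; omega⟩)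

/-- Pairs of consecutive stubs are the same as stubs. -/
def stubEquiv (m : ℕ) : Fin m × Fin 2 ≃ Fin (2 * m) :=
  finProdFinEquiv.trans (finCongr (mul_comm m 2))

lemma stubEquiv_zero {m : ℕ} (e : Fin m) :
    stubEquiv m (e, 0) = ⟨2 * (e : ℕ), by have := e.isLt; omega⟩ := by
  ext; simp [stubEquiv, finProdFinEquiv]

lemma stubEquiv_one {m : ℕ} (e : Fin m) :
    stubEquiv m (e, 1) = ⟨2 * (e : ℕ) + 1, by have := e.isLt; omega⟩ := by
  ext; simp [stubEquiv, finProdFinEquiv, add_comm]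

lemma stubPair_bijective (C : Type*) (m : ℕ) :
    Function.Bijective (stubPair : (Fin (2 * m) → C) → Fin m → C × C) := by
  constructor
  · intro ψ ψ' h
    funext l
    obtain ⟨⟨e, b⟩, rfl⟩ := (stubEquiv m).surjective l
    have he := congrFun h e
    simp only [stubPair, Prod.mk.injEq, ← stubEquiv_zero, ← stubEquiv_one] at he
    fin_cases b
    · exact he.1
    · exact he.2
  · intro g
    refine ⟨fun l => if ((stubEquiv m).symm l).2 = 0 then (g ((stubEquiv m).symm l).1).1
      else (g ((stubEquiv m).symm l).1).2, ?_⟩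
    funext e
    simp [stubPair, ← stubEquiv_zero, ← stubEquiv_one]

lemma prod_stubPair {m : ℕ} (f : C → ℝ) (ψ : Fin (2 * m) → C) :
    ∏ l, f (ψ l) = ∏ e, (f (stubPair ψ e).1 * f (stubPair ψ e).2) := by
  rw [← (stubEquiv m).prod_comp, Fintype.prod_prod_type]
  simp only [Fin.prod_univ_two, stubPair, stubEquiv_zero, stubEquiv_one]

variable [DecidableEq C] [DecidableEq V]

/-- The number of edges joining the given unordered pair of colours. -/
def edgeCount {m : ℕ} (ψ : Fin (2 * m) → C) (t : Sym2 C) : ℕ :=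
  #{e | s((stubPair ψ e).1, (stubPair ψ e).2) = t}

lemma stubAdj_of_ne {m n : ℕ} (ψ : Fin (2 * m) → Fin n) {i j : Fin n} (hij : i ≠ j) :
    stubAdj ψ i j = edgeCount ψ s(i, j) := by
  unfold stubAdj edgeCount stubPair
  rw [Finset.card_filter]
  refine sum_congr rfl fun e _ => ?_
  simp only [Sym2.eq_iff]
  split_ifs <;> grind

lemma stubAdj_self {m n : ℕ} (ψ : Fin (2 * m) → Fin n) (i : Fin n) :
    stubAdj ψ i i = 2 * edgeCount ψ s(i, i) := by
  unfold stubAdj edgeCount stubPair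
  rw [Finset.card_filter, mul_sum]
  refine sum_congr rfl fun e _ => ?_
  simp only [Sym2.eq_iff, or_self]
  split_ifs <;> rfl

/-- Colours outside the range of `g` are merged into `none`. -/
lemma edgeCount_partialInv_comp {g : V → C} (hg : Function.Injective g) {m : ℕ}
    (ψ : Fin (2 * m) → C) (t : Sym2 V) :
    edgeCount (Function.partialInv g ∘ ψ) (t.map some) = edgeCount ψ (t.map g) := by
  have h : ∀ b v, Function.partialInv g b = some v ↔ g v = b := fun b v => hg.isPartialInv v b
  unfold edgeCount
  congr 1
  ext e
  induction t with
  | _ u v =>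
    simp only [mem_filter_univ, stubPair, Function.comp, Sym2.map_mk, Sym2.eq_iff, h]
    simp only [eq_comm]

variable [Fintype V]

/-- The limiting expected number of edges in a cell, given the relative masses `x`. -/
noncomputable def edgeIntensity (ρ : ℝ) (x : V → ℝ) (t : Sym2 V) : ℝ :=
  ∑ d : V × V with s(d.1, d.2) = t, x d.1 * x d.2 / (2 * ρ)

lemma edgeIntensity_of_ne (ρ : ℝ) (x : V → ℝ) {i j : V} (hij : i ≠ j) :
    edgeIntensity ρ x s(i, j) = x i * x j / ρ := by
  have : ({d : V × V | s(d.1, d.2) = s(i, j)} : Finset (V × V)) = {(i, j), (j, i)} := by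
    ext ⟨u, v⟩
    simp
  rw [edgeIntensity, this, sum_pair (by simp [hij])]
  ring

lemma edgeIntensity_self (ρ : ℝ) (x : V → ℝ) (i : V) :
    edgeIntensity ρ x s(i, i) = x i * x i / (2 * ρ) := by
  have : ({d : V × V | s(d.1, d.2) = s(i, i)} : Finset (V × V)) = {(i, i)} := by
    ext ⟨u, v⟩
    simp
  rw [edgeIntensity, this, sum_singleton]

variable [Fintype τ]

/-- Conditional probability, given masses `p`, that the cells `ι t` have edge counts `a t`. -/
noncomputable def condProb (ι : τ → Sym2 V) (a : τ → ℕ) (m : ℕ) (p : Option V → ℝ) : ℝ :=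
  ∑ χ : Fin (2 * m) → Option V,
    if ∀ t, edgeCount χ ((ι t).map some) = a t then ∏ l, p (χ l) else 0

lemma condProb_nonneg (ι : τ → Sym2 V) (a : τ → ℕ) (m : ℕ) {p : Option V → ℝ}
    (hp : ∀ o, 0 ≤ p o) : 0 ≤ condProb ι a m p :=
  sum_nonneg fun _ _ => by
    split_ifs
    exacts [prod_nonneg fun _ _ => hp _, le_rfl]

lemma condProb_le_one (ι : τ → Sym2 V) (a : τ → ℕ) (m : ℕ) {p : Option V → ℝ}
    (hp : ∀ o, 0 ≤ p o) (hp1 : ∑ o, p o = 1) : condProb ι a m p ≤ 1 := by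
  calc condProb ι a m p ≤ ∑ χ : Fin (2 * m) → Option V, ∏ l, p (χ l) :=
        sum_le_sum fun _ _ => by
          split_ifs
          exacts [le_rfl, prod_nonneg fun _ _ => hp _]
    _ = (∑ o, p o) ^ (2 * m) := by rw [Fintype.sum_pow]
    _ = 1 := by rw [hp1, one_pow]

variable [DecidableEq τ]

lemma condProb_eq {ι : τ → Sym2 V} (hι : Function.Injective ι) (a : τ → ℕ) (m : ℕ)
    {p : Option V → ℝ} (hp1 : ∑ o, p o = 1) :
    condProb ι a m p = m.choose (∑ t, a t) *
      (1 - ∑ t, ∑ d : V × V with s(d.1, d.2) = ι t, p (some d.1) * p (some d.2)) ^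
        (m - ∑ t, a t) * (Nat.multinomial univ a *
      ∏ t, (∑ d : V × V with s(d.1, d.2) = ι t, p (some d.1) * p (some d.2)) ^ a t) := by
  have hinj : Function.Injective fun t => (ι t).map some :=
    (Sym2.map.injective (Option.some_injective V)).comp hι
  set c : Option V × Option V → Option τ :=
    fun d => Function.partialInv (fun t => (ι t).map some) s(d.1, d.2) with hc
  have hct : ∀ d t, c d = some t ↔ s(d.1, d.2) = (ι t).map some := fun d t =>
    (hinj.isPartialInv t s(d.1, d.2)).trans eq_comm
  set w : Option V × Option V → ℝ := fun d => p d.1 * p d.2 with hw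
  have hq : ∀ t, ∑ d with c d = some t, w d =
      ∑ d : V × V with s(d.1, d.2) = ι t, p (some d.1) * p (some d.2) := fun t => by
    simp only [sum_filter, hct, hw, Fintype.sum_prod_type, Fintype.sum_option]
    generalize ι t = z
    induction z with
    | _ u v => simp
  have hq0 : ∑ d with c d = none, w d = 1 - ∑ t, ∑ d with c d = some t, w d := by
    have h1 : ∑ d, w d = 1 := by
      rw [Fintype.sum_prod_type, ← Fintype.sum_mul_sum, hp1, one_mul]
    rw [← Finset.sum_fiberwise univ c, Fintype.sum_option] at h1
    linarith
  simp only [← hq]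
  rw [← hq0, ← sum_count_eq_multinomial, condProb]
  refine Fintype.sum_bijective _ (stubPair_bijective (Option V) m) _ _ fun χ => ?_
  rw [prod_stubPair]
  refine if_congr ?_ rfl rfl
  simp only [hct, edgeCount]

lemma tendsto_condProb {ρ : ℝ} (hρ : 0 < ρ) {m : ℕ → ℕ}
    (hm : Tendsto (fun n : ℕ => (2 * m n : ℝ) / (n : ℝ) ^ 2) atTop (nhds ρ))
    {ι : τ → Sym2 V} (hι : Function.Injective ι) (a : τ → ℕ) {x : V → ℝ} (hx : ∀ v, 0 < x v) :
    Tendsto (fun n : ℕ => condProb ι a (m n) (mixProb (ρ * n) x)) atTop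
      (nhds (∏ t, poissonWeight (a t) (edgeIntensity ρ x (ι t)))) := by
  have hn : Tendsto (fun n : ℕ => (n : ℝ)) atTop atTop := tendsto_natCast_atTop_atTop
  have hmr : Tendsto (fun n : ℕ => (m n : ℝ)) atTop atTop := by
    have h := (hm.div_const 2).pos_mul_atTop (half_pos hρ)
      ((tendsto_pow_atTop two_ne_zero).comp hn)
    refine h.congr' ?_
    filter_upwards [eventually_gt_atTop 0] with n hn
    simp only [Function.comp]
    have : (0 : ℝ) < n := by exact_mod_cast hn
    field_simp
  have hS : Tendsto (fun n : ℕ => 1 + (∑ v, x v) / (ρ * n)) atTop (nhds 1) := by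
    have := (Tendsto.const_mul_atTop hρ hn).const_div_atTop (∑ v, x v)
    simpa using this.const_add 1
  have hd : ∀ u v, Tendsto (fun n : ℕ => (m n : ℝ) *
      (mixProb (ρ * n) x (some u) * mixProb (ρ * n) x (some v))) atTop
      (nhds (x u * x v / (2 * ρ))) := fun u v => by
    have h := (hm.mul_const (x u * x v / (2 * ρ ^ 2))).mul ((hS.pow 2).inv₀ (by simp))
    rw [one_pow, inv_one, mul_one,
      show ρ * (x u * x v / (2 * ρ ^ 2)) = x u * x v / (2 * ρ) by field_simp] at h
    refine h.congr' ?_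
    filter_upwards [eventually_gt_atTop 0] with n hn
    have : (0 : ℝ) < n := by exact_mod_cast hn
    simp only [mixProb, Option.elim]
    generalize 1 + (∑ v, x v) / (ρ * n) = y
    simp only [div_eq_mul_inv, mul_inv]
    ring
  have hmN : Tendsto m atTop atTop := tendsto_natCast_atTop_iff.1 hmr
  have hmul := tendsto_multinomial_poisson hmN
    (q := fun (n : ℕ) t => ∑ d : V × V with s(d.1, d.2) = ι t,
      mixProb (ρ * n) x (some d.1) * mixProb (ρ * n) x (some d.2))
    (lam := fun t => edgeIntensity ρ x (ι t))
    (fun t => by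
      simp only [mul_sum]
      exact tendsto_finsetSum _ fun d _ => hd d.1 d.2) a
  refine hmul.congr' ?_
  filter_upwards [eventually_gt_atTop 0] with n hn
  have : (0 : ℝ) < n := by exact_mod_cast hn
  rw [condProb_eq hι a (m n) (sum_mixProb (by positivity) hx)]

end Pairing

section Coarse

variable {V τ : Type*} [Fintype V] [DecidableEq V] [Fintype τ]

/-- The probability that the cells `ι t` have edge counts `a t` in an urn of `n` colours, where
all colours outside `V` have been merged into `none`. -/
noncomputable def coarseProb (κ : ℝ) (ι : τ → Sym2 V) (a : τ → ℕ) (m n : ℕ) : ℝ :=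
  (∑ χ : Fin (2 * m) → Option V, if ∀ t, edgeCount χ ((ι t).map some) = a t then
    urnWeight (fun o : Option V => o.elim (κ * n - κ * Fintype.card V) fun _ => κ) χ else 0) /
      ∏ j ∈ range (2 * m), (κ * n + j)

/-- The limit of the probability that the cells `ι t` have edge counts `a t`. -/
noncomputable def limitProb (κ ρ : ℝ) (ι : τ → Sym2 V) (a : τ → ℕ) : ℝ :=
  ∫ x, ∏ t, poissonWeight (a t) (edgeIntensity ρ x (ι t)) ∂gammaPi V κ (κ / ρ)

lemma measurable_condProb (ι : τ → Sym2 V) (a : τ → ℕ) (m : ℕ) (r : ℝ) :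
    Measurable fun x : V → ℝ => condProb ι a m (mixProb r x) := by
  unfold condProb
  refine Finset.measurable_sum _ fun χ _ => ?_
  split_ifs
  exacts [Finset.measurable_prod _ fun l _ => measurable_mixProb r (χ l), measurable_const]

lemma coarseProb_mul_integral {κ ρ : ℝ} (hκ : 0 < κ) (hρ : 0 < ρ) (ι : τ → Sym2 V) (a : τ → ℕ)
    (m : ℕ) {n : ℕ} (hn : Fintype.card V < n) :
    coarseProb κ ι a m n * ∫ x, mixDensity (κ / ρ) (ρ * n) (κ * n) x ∂gammaPi V κ (κ / ρ) =
      ∫ x, mixDensity (κ / ρ) (ρ * n) (κ * n) x * condProb ι a m (mixProb (ρ * n) x)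
        ∂gammaPi V κ (κ / ρ) := by
  have hn0 : (0 : ℝ) < n := by exact_mod_cast (Nat.zero_le _).trans_lt hn
  have hB : κ * Fintype.card V < κ * n := by
    have : (Fintype.card V : ℝ) < n := by exact_mod_cast hn
    gcongr
  have hθ : 0 < κ / ρ := by positivity
  have hr : 0 < ρ * n := by positivity
  have H := fun χ : Fin (2 * m) → Option V => integral_mixDensity_mul_prod hκ hθ hr hB χ
  simp only [condProb, mul_sum]
  rw [integral_finsetSum]
  · rw [coarseProb, sum_div, sum_mul]
    refine sum_congr rfl fun χ _ => ?_
    split_ifs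
    · rw [(H χ).2, mul_comm]
    · simp
  · intro χ _
    split_ifs
    · exact (H χ).1
    · simp

lemma tendsto_coarseProb [DecidableEq τ] {κ ρ : ℝ} (hκ : 0 < κ) (hρ : 0 < ρ) {m : ℕ → ℕ}
    (hm : Tendsto (fun n : ℕ => (2 * m n : ℝ) / (n : ℝ) ^ 2) atTop (nhds ρ))
    {ι : τ → Sym2 V} (hι : Function.Injective ι) (a : τ → ℕ) :
    Tendsto (fun n : ℕ => coarseProb κ ι a (m n) n) atTop (nhds (limitProb κ ρ ι a)) := by
  have hθ : 0 < κ / ρ := by positivity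
  set N := Fintype.card V + 1 with hN
  have hpos := ae_gammaPi_pos (V := V) hκ hθ
  have h_int : Integrable (mixDensity (κ / ρ) (ρ * N) (κ * N)) (gammaPi V κ (κ / ρ)) := by
    refine integrable_mixDensity hκ hθ (by rw [hN]; positivity) ?_
    have : (Fintype.card V : ℝ) < N := by exact_mod_cast Nat.lt_succ_self _
    gcongr
  have h0 : ∀ n ≥ N, ∀ x : V → ℝ, (∀ v, 0 < x v) →
      0 ≤ mixDensity (κ / ρ) (ρ * n) (κ * n) x := fun n hn x hx => by
    have : (0 : ℝ) < n := by exact_mod_cast (Nat.succ_pos _).trans_le hn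
    exact (mixDensity_pos (by positivity) hx).le
  have hJ : Tendsto (fun n : ℕ => ∫ x, mixDensity (κ / ρ) (ρ * n) (κ * n) x
      ∂gammaPi V κ (κ / ρ)) atTop (nhds 1) := by
    have : IsProbabilityMeasure (gammaMeasure κ (κ / ρ)) := isProbabilityMeasure_gammaMeasure hκ hθ
    rw [show (1 : ℝ) = ∫ _, (1 : ℝ) ∂gammaPi V κ (κ / ρ) by simp [gammaPi]]
    refine tendsto_integral_filter_of_dominated_convergence _
      (Eventually.of_forall fun n => (measurable_mixDensity _ _ _).aestronglyMeasurable) ?_ h_int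
      (Eventually.of_forall fun x => mixDensity_tendsto κ ρ x)
    filter_upwards [eventually_ge_atTop N] with n hn
    filter_upwards [hpos] with x hx
    rw [Real.norm_of_nonneg (h0 n hn x hx)]
    exact mixDensity_le hκ hρ hx (Nat.succ_pos _) hn
  have hI : Tendsto (fun n : ℕ => ∫ x, mixDensity (κ / ρ) (ρ * n) (κ * n) x *
      condProb ι a (m n) (mixProb (ρ * n) x) ∂gammaPi V κ (κ / ρ)) atTop
      (nhds (limitProb κ ρ ι a)) := by
    refine tendsto_integral_filter_of_dominated_convergence _
      (Eventually.of_forall fun n => ((measurable_mixDensity _ _ _).mul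
        (measurable_condProb ι a _ _)).aestronglyMeasurable) ?_ h_int ?_
    · filter_upwards [eventually_ge_atTop N] with n hn
      filter_upwards [hpos] with x hx
      have hn0 : (0 : ℝ) < n := by exact_mod_cast (Nat.succ_pos _).trans_le hn
      have hp := mixProb_nonneg (r := ρ * n) (by positivity) hx
      rw [Real.norm_of_nonneg (mul_nonneg (h0 n hn x hx) (condProb_nonneg _ _ _ hp))]
      exact (mul_le_of_le_one_right (h0 n hn x hx)
        (condProb_le_one _ _ _ hp (sum_mixProb (by positivity) hx))).trans
        (mixDensity_le hκ hρ hx (Nat.succ_pos _) hn)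
    · filter_upwards [hpos] with x hx
      simpa using (mixDensity_tendsto κ ρ x).mul (tendsto_condProb hρ hm hι a hx)
  have h := hI.div hJ one_ne_zero
  rw [div_one] at h
  refine h.congr' ?_
  filter_upwards [eventually_ge_atTop N, hJ.eventually_ne one_ne_zero] with n hn hne
  simp only [Pi.div_apply]
  rw [← coarseProb_mul_integral hκ hρ ι a (m n) hn, mul_div_cancel_right₀ _ hne]

end Coarse

section Average

variable {V τ : Type*} [Fintype V] [DecidableEq V] [Fintype τ]

lemma sum_polyaProb_edgeCount (κ : ℝ) (ι : τ → Sym2 V) (a : τ → ℕ) {m n : ℕ} {g : V → Fin n}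
    (hg : Function.Injective g) :
    ∑ ψ : Fin (2 * m) → Fin n, polyaProb κ ψ *
      (if ∀ t, edgeCount ψ ((ι t).map g) = a t then 1 else 0) = coarseProb κ ι a m n := by
  have hiff : ∀ b v, Function.partialInv g b = some v ↔ g v = b := fun b v => hg.isPartialInv v b
  have hfib : ∀ v, ∑ b with Function.partialInv g b = some v, κ = κ := fun v => by
    simp [hiff, Finset.filter_eq]
  have h1 := Finset.sum_fiberwise univ (Function.partialInv g) fun _ => κ
  rw [Fintype.sum_option] at h1
  simp only [hfib, sum_const, Finset.card_univ, Fintype.card_fin, nsmul_eq_mul] at h1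
  have hw : (fun o : Option V => ∑ b with Function.partialInv g b = o, κ) =
      fun o => o.elim (κ * n - κ * Fintype.card V) fun _ => κ := by
    funext o
    cases o with
    | none => simp only [sum_const, nsmul_eq_mul, Option.elim]; linarith
    | some v => exact hfib v
  have h := sum_urnWeight_mul_comp (M := 2 * m) (fun _ : Fin n => κ) (Function.partialInv g)
    fun χ => if ∀ t, edgeCount χ ((ι t).map some) = a t then 1 else 0
  simp only [edgeCount_partialInv_comp hg, hw] at h
  simp only [polyaProb_eq, div_mul_eq_mul_div, ← sum_div, h]
  simp only [coarseProb, mul_ite, mul_one, mul_zero]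

lemma tendsto_average {u : ∀ n : ℕ, (V → Fin n) → ℝ} {q : ℕ → ℝ} {L : ℝ}
    (h0 : ∀ n g, 0 ≤ u n g) (h1 : ∀ n g, u n g ≤ 1)
    (hu : ∀ n g, Function.Injective g → u n g = q n) (hq : Tendsto q atTop (nhds L)) :
    Tendsto (fun n : ℕ => (∑ g, u n g) / (n : ℝ) ^ Fintype.card V) atTop (nhds L) := by
  classical
  set K := Fintype.card V
  have hcard : ∀ n : ℕ, #{g : V → Fin n | Function.Injective g} = n.descFactorial K := fun n => by
    rw [← Fintype.card_subtype, Fintype.card_congr (Equiv.subtypeInjectiveEquivEmbedding V (Fin n)),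
      Fintype.card_embedding_eq, Fintype.card_fin]
  have hc : Tendsto (fun n : ℕ => (n.descFactorial K : ℝ) / (n : ℝ) ^ K) atTop (nhds 1) := by
    refine (Asymptotics.isEquivalent_iff_tendsto_one ?_).1 (isEquivalent_descFactorial K)
    filter_upwards [eventually_gt_atTop 0] with n hn
    positivity
  have hsplit : ∀ n : ℕ, ∑ g, u n g = n.descFactorial K * q n +
      ∑ g with ¬ Function.Injective g, u n g := fun n => by
    rw [← Finset.sum_filter_add_sum_filter_not univ fun g : V → Fin n => Function.Injective g,
      sum_congr rfl fun g hg => hu n g (mem_filter.1 hg).2, sum_const, hcard, nsmul_eq_mul]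
  have hrest : ∀ n : ℕ, ∑ g with ¬ Function.Injective g, u n g ≤
      (n : ℝ) ^ K - n.descFactorial K := fun n => by
    have h := Finset.card_filter_add_card_filter_not (s := univ)
      fun g : V → Fin n => Function.Injective g
    rw [hcard, Finset.card_univ, Fintype.card_fun, Fintype.card_fin] at h
    have h' : (n.descFactorial K : ℝ) + #{g : V → Fin n | ¬ Function.Injective g} = (n : ℝ) ^ K := by
      exact_mod_cast h
    calc _ ≤ ∑ g : V → Fin n with ¬ Function.Injective g, (1 : ℝ) := sum_le_sum fun g _ => h1 n g
      _ = _ := by rw [sum_const, nsmul_one]; linarith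
  have hlow := hc.mul hq
  have hup := hlow.add (hc.const_sub 1)
  rw [one_mul] at hlow
  rw [one_mul, sub_self, add_zero] at hup
  refine tendsto_of_tendsto_of_tendsto_of_le_of_le' hlow hup ?_ ?_
  · filter_upwards [eventually_gt_atTop 0] with n hn
    rw [hsplit, div_mul_eq_mul_div]
    gcongr
    exact le_add_of_nonneg_right (sum_nonneg fun g _ => h0 n g)
  · filter_upwards [eventually_gt_atTop 0] with n hn
    have hn' : (0 : ℝ) < (n : ℝ) ^ K := by positivity
    rw [hsplit, div_mul_eq_mul_div, add_div]
    gcongr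
    rw [one_sub_div hn'.ne']
    gcongr
    exact hrest n

/-- The average probability of an event which, along injections, prescribes edge counts. -/
lemma tendsto_average_event [DecidableEq τ] {κ ρ : ℝ} (hκ : 0 < κ) (hρ : 0 < ρ) {m : ℕ → ℕ}
    (hm : Tendsto (fun n : ℕ => (2 * m n : ℝ) / (n : ℝ) ^ 2) atTop (nhds ρ))
    {ι : τ → Sym2 V} (hι : Function.Injective ι) (a : τ → ℕ)
    (E : ∀ n : ℕ, (V → Fin n) → (Fin (2 * m n) → Fin n) → Prop) [∀ n g ψ, Decidable (E n g ψ)]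
    (hE : ∀ n g ψ, Function.Injective g → (E n g ψ ↔ ∀ t, edgeCount ψ ((ι t).map g) = a t)) :
    Tendsto (fun n : ℕ => ∑ ψ : Fin (2 * m n) → Fin n, polyaProb κ ψ *
      ((∑ g, if E n g ψ then 1 else 0) / (n : ℝ) ^ Fintype.card V)) atTop
      (nhds (limitProb κ ρ ι a)) := by
  have h := tendsto_average (u := fun n g => if n = 0 then 0 else
      ∑ ψ : Fin (2 * m n) → Fin n, polyaProb κ ψ * if E n g ψ then 1 else 0)
    (q := fun n => if n = 0 then 0 else coarseProb κ ι a (m n) n)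
    (L := limitProb κ ρ ι a) (fun n g => ?_) (fun n g => ?_) (fun n g hg => ?_) ?_
  · refine h.congr' ?_
    filter_upwards [eventually_ne_atTop 0] with n hn
    simp only [if_neg hn]
    simp only [sum_comm (s := univ (α := V → Fin n)), ← mul_sum, sum_div, mul_div_assoc]
  · split_ifs
    · rfl
    · exact sum_nonneg fun ψ _ => mul_nonneg (polyaProb_nonneg hκ.le ψ) (by split_ifs <;> simp)
  · split_ifs with hn
    · exact zero_le_one
    · refine le_trans ?_ (sum_polyaProb hκ (2 * m n) hn).le
      refine sum_le_sum fun ψ _ => mul_le_of_le_one_right (polyaProb_nonneg hκ.le ψ) ?_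
      split_ifs
      exacts [le_rfl, zero_le_one]
  · simp only [fun ψ => hE n g ψ hg, sum_polyaProb_edgeCount κ ι a hg]
  · refine (tendsto_coarseProb hκ hρ hm hι a).congr' ?_
    filter_upwards [eventually_ne_atTop 0] with n hn
    rw [if_neg hn]

end Average

section SecondMoment

lemma tendsto_sum_ite_of_moments {α : ℕ → Type*} [∀ n, Fintype (α n)] {w T : ∀ n, α n → ℝ} {L ε : ℝ}
    (hw : ∀ n y, 0 ≤ w n y) (hw1 : ∀ᶠ n in atTop, ∑ y, w n y = 1)
    (h1 : Tendsto (fun n => ∑ y, w n y * T n y) atTop (nhds L))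
    (h2 : Tendsto (fun n => ∑ y, w n y * T n y ^ 2) atTop (nhds (L ^ 2))) (hε : 0 < ε) :
    Tendsto (fun n => ∑ y, w n y * (if ε < |T n y - L| then (1 : ℝ) else 0)) atTop (nhds 0) := by
  have h := ((h2.sub (h1.const_mul (2 * L))).add_const (L ^ 2)).div_const (ε ^ 2)
  rw [show (L ^ 2 - 2 * L * L + L ^ 2) / ε ^ 2 = 0 by ring] at h
  refine squeeze_zero' (Eventually.of_forall fun n => sum_nonneg fun y _ =>
    mul_nonneg (hw n y) (by split_ifs <;> simp)) ?_ h
  filter_upwards [hw1] with n hn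
  have e : ∑ y, w n y * T n y ^ 2 - 2 * L * ∑ y, w n y * T n y + L ^ 2 =
      ∑ y, w n y * (T n y - L) ^ 2 := by
    calc _ = ∑ y, w n y * T n y ^ 2 - 2 * L * ∑ y, w n y * T n y + (∑ y, w n y) * L ^ 2 := by
          rw [hn, one_mul]
      _ = _ := by
          rw [mul_sum, sum_mul, ← sum_sub_distrib, ← sum_add_distrib]
          exact sum_congr rfl fun y _ => by ring
  rw [e, sum_div]
  refine sum_le_sum fun y _ => ?_
  rw [mul_div_assoc]
  refine mul_le_mul_of_nonneg_left ?_ (hw n y)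
  split_ifs with hy
  · rw [one_le_div (by positivity), ← sq_abs (T n y - L)]
    gcongr
  · positivity

variable {V : Type*}

lemma exists_cellCount [DecidableEq V] {A : V → V → ℕ} (hsymA : ∀ i j, A i j = A j i)
    (hevenA : ∀ i, 2 ∣ A i i) :
    ∃ a : Sym2 V → ℕ, (∀ i j, i ≠ j → a s(i, j) = A i j) ∧ ∀ i, 2 * a s(i, i) = A i i := by
  refine ⟨Sym2.lift ⟨fun i j => if i = j then A i j / 2 else A i j, fun i j => ?_⟩, ?_, ?_⟩
  · simp only [eq_comm (a := i), hsymA i j]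
  · intro i j hij
    simp [hij]
  · intro i
    simpa using Nat.mul_div_cancel' (hevenA i)

lemma forall_eq_stubAdj_iff {A : V → V → ℕ} {a : Sym2 V → ℕ}
    (ha : ∀ i j, i ≠ j → a s(i, j) = A i j) (ha' : ∀ i, 2 * a s(i, i) = A i i) {m n : ℕ}
    (ψ : Fin (2 * m) → Fin n) {g : V → Fin n} (hg : Function.Injective g) :
    (∀ i j, A i j = stubAdj ψ (g i) (g j)) ↔ ∀ t : Sym2 V, edgeCount ψ (t.map g) = a t := by
  have key : ∀ i j, A i j = stubAdj ψ (g i) (g j) ↔ edgeCount ψ s(g i, g j) = a s(i, j) := by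
    intro i j
    by_cases hij : i = j
    · subst hij
      rw [stubAdj_self, ← ha']
      omega
    · rw [stubAdj_of_ne ψ (hg.ne hij), ← ha i j hij, eq_comm]
  simp only [key]
  exact ⟨fun h t => t.ind h, fun h i j => h s(i, j)⟩

variable [Fintype V] [DecidableEq V]

lemma edgeIntensity_map {U : Type*} [Fintype U] [DecidableEq U] (ρ : ℝ) (x : U → ℝ) {g : V → U}
    (hg : Function.Injective g) (t : Sym2 V) :
    edgeIntensity ρ x (t.map g) = edgeIntensity ρ (fun v => x (g v)) t := by
  induction t with
  | _ i j =>
    by_cases hij : i = j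
    · subst hij
      rw [Sym2.map_mk, edgeIntensity_self, edgeIntensity_self]
    · rw [Sym2.map_mk, edgeIntensity_of_ne ρ x (hg.ne hij), edgeIntensity_of_ne _ _ hij]

/-- The unordered pairs in the disjoint union of two copies of `V` not joining the copies. -/
def doublePair (V : Type*) : Sym2 V ⊕ Sym2 V → Sym2 (V ⊕ V) :=
  Sum.elim (Sym2.map Sum.inl) (Sym2.map Sum.inr)

lemma doublePair_injective (V : Type*) : Function.Injective (doublePair V) := by
  refine (Sym2.map.injective Sum.inl_injective).sumElim (Sym2.map.injective Sum.inr_injective) ?_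
  intro s t
  induction s
  induction t
  simp

lemma limitProb_doublePair {κ ρ : ℝ} (hκ : 0 < κ) (hρ : 0 < ρ) (a : Sym2 V → ℕ) :
    limitProb κ ρ (doublePair V) (Sum.elim a a) = limitProb κ ρ (id : Sym2 V → Sym2 V) a ^ 2 := by
  have : IsProbabilityMeasure (gammaMeasure κ (κ / ρ)) :=
    isProbabilityMeasure_gammaMeasure hκ (by positivity)
  have hmp := measurePreserving_sumPiEquivProdPi
    (fun _ : V ⊕ V => gammaMeasure κ (κ / ρ))
  simp only [limitProb, gammaPi, Fintype.prod_sum_type, doublePair, Sum.elim_inl, Sum.elim_inr,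
    edgeIntensity_map _ _ Sum.inl_injective, edgeIntensity_map _ _ Sum.inr_injective, id]
  rw [sq, ← integral_prod_mul]
  exact hmp.integral_comp' (g := fun z : (V → ℝ) × (V → ℝ) =>
    (∏ t, poissonWeight (a t) (edgeIntensity ρ z.1 t)) *
      ∏ t, poissonWeight (a t) (edgeIntensity ρ z.2 t))

lemma tind_sq {k n : ℕ} (A : Fin k → Fin k → ℕ) (B : Fin n → Fin n → ℕ) :
    tind A B ^ 2 = (∑ g : Fin k ⊕ Fin k → Fin n,
      if (∀ i j, A i j = B (g (.inl i)) (g (.inl j))) ∧ (∀ i j, A i j = B (g (.inr i)) (g (.inr j)))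
      then 1 else 0) / (n : ℝ) ^ Fintype.card (Fin k ⊕ Fin k) := by
  rw [tind, div_pow, sq (∑ _, _), Fintype.sum_mul_sum, Fintype.card_sum, Fintype.card_fin,
    ← pow_mul, mul_two, ← Fintype.sum_prod_type',
    ← (Equiv.sumArrowEquivProdArrow (Fin k) (Fin k) (Fin n)).sum_comp]
  congr 1
  refine sum_congr rfl fun g _ => ?_
  rw [ite_and, ite_mul, one_mul, zero_mul]
  rfl

lemma tendsto_prob_tind {κ ρ : ℝ} (hκ : 0 < κ) (hρ : 0 < ρ) {m : ℕ → ℕ}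
    (hm : Tendsto (fun n : ℕ => (2 * m n : ℝ) / (n : ℝ) ^ 2) atTop (nhds ρ))
    {k : ℕ} {A : Fin k → Fin k → ℕ} {a : Sym2 (Fin k) → ℕ}
    (ha : ∀ i j, i ≠ j → a s(i, j) = A i j) (ha' : ∀ i, 2 * a s(i, i) = A i i)
    {ε : ℝ} (hε : 0 < ε) :
    Tendsto (fun n : ℕ => ∑ ψ : Fin (2 * m n) → Fin n, polyaProb κ ψ *
      (if ε < |tind A (stubAdj ψ) - limitProb κ ρ id a| then (1 : ℝ) else 0)) atTop (nhds 0) := by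
  refine tendsto_sum_ite_of_moments (fun n ψ => polyaProb_nonneg hκ.le ψ) ?_ ?_ ?_ hε
  · filter_upwards [eventually_ne_atTop 0] with n hn
    exact sum_polyaProb hκ _ hn
  · have h := tendsto_average_event hκ hρ hm (ι := (id : Sym2 (Fin k) → Sym2 (Fin k)))
      Function.injective_id a (fun n g ψ => ∀ i j, A i j = stubAdj ψ (g i) (g j))
      fun n g ψ hg => forall_eq_stubAdj_iff ha ha' ψ hg
    simpa only [tind, Fintype.card_fin] using h
  · rw [← limitProb_doublePair hκ hρ]
    simp only [tind_sq]
    refine tendsto_average_event hκ hρ hm (doublePair_injective (Fin k)) (Sum.elim a a)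
      (fun n g ψ => (∀ i j, A i j = stubAdj ψ (g (.inl i)) (g (.inl j))) ∧
        ∀ i j, A i j = stubAdj ψ (g (.inr i)) (g (.inr j))) fun n g ψ hg => ?_
    have hl := forall_eq_stubAdj_iff ha ha' ψ (hg.comp Sum.inl_injective)
    have hr := forall_eq_stubAdj_iff ha ha' ψ (hg.comp Sum.inr_injective)
    simp only [Function.comp] at hl hr
    simp only [hl, hr, Sum.forall, doublePair, Sum.elim_inl, Sum.elim_inr, Sym2.map_map]
    rfl

end SecondMoment

section Quantile

lemma csInf_setOf_le_cdf_le_iff (μ : Measure ℝ) {u : ℝ} (h0 : 0 < u) (h1 : u < 1) (z : ℝ) :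
    sInf {y | u ≤ cdf μ y} ≤ z ↔ u ≤ cdf μ z := by
  have hne : {y | u ≤ cdf μ y}.Nonempty :=
    ((tendsto_cdf_atTop μ).eventually_const_le h1).exists
  have hbdd : BddBelow {y | u ≤ cdf μ y} := by
    obtain ⟨b, hb⟩ := ((tendsto_cdf_atBot μ).eventually_lt_const h0).exists
    exact ⟨b, fun y hy => le_of_not_gt fun hyb => absurd hb
      (not_lt.2 (le_trans hy (monotone_cdf μ hyb.le)))⟩
  refine ⟨fun h => ?_, fun h => csInf_le hbdd h⟩
  refine ge_of_tendsto (((cdf μ).right_continuous z).mono Set.Ioi_subset_Ici_self) ?_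
  filter_upwards [self_mem_nhdsWithin] with y hy
  obtain ⟨s, hs, hsy⟩ := exists_lt_of_csInf_lt hne (h.trans_lt hy)
  exact le_trans hs (monotone_cdf μ hsy.le)

instance : IsProbabilityMeasure unifI := ⟨by simp [unifI]⟩

lemma unifI_eq_restrict_Ioo : unifI = volume.restrict (Set.Ioo 0 1) :=
  (Measure.restrict_congr_set Ioo_ae_eq_Icc).symm

lemma aemeasurable_sInf_cdf (μ : Measure ℝ) :
    AEMeasurable (fun u => sInf {y | u ≤ cdf μ y}) unifI := by
  rw [unifI_eq_restrict_Ioo]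
  refine aemeasurable_restrict_of_monotoneOn measurableSet_Ioo fun u hu v hv huv => ?_
  rw [csInf_setOf_le_cdf_le_iff μ hu.1 hu.2]
  exact huv.trans ((csInf_setOf_le_cdf_le_iff μ hv.1 hv.2 _).1 le_rfl)

/-- The generalised inverse of the distribution function transports the uniform measure. -/
lemma map_sInf_cdf (μ : Measure ℝ) [IsProbabilityMeasure μ] :
    unifI.map (fun u => sInf {y | u ≤ cdf μ y}) = μ := by
  have hm := aemeasurable_sInf_cdf μ
  have := Measure.isProbabilityMeasure_map hm
  refine Measure.ext_of_Iic _ _ fun z => ?_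
  rw [Measure.map_apply_of_aemeasurable hm measurableSet_Iic, ← ofReal_cdf]
  calc unifI ((fun u => sInf {y | u ≤ cdf μ y}) ⁻¹' Set.Iic z) = unifI (Set.Iic (cdf μ z)) := by
        refine measure_congr ?_
        rw [unifI_eq_restrict_Ioo]
        filter_upwards [ae_restrict_mem measurableSet_Ioo] with u hu
        exact propext (csInf_setOf_le_cdf_le_iff μ hu.1 hu.2 z)
    _ = ENNReal.ofReal (cdf μ z) := by
        rw [unifI, Measure.restrict_apply measurableSet_Iic, Set.inter_comm, ← Set.Ici_inter_Iic,
          Set.inter_assoc, Set.Iic_inter_Iic, min_eq_right (cdf_le_one μ z), Set.Ici_inter_Iic,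
          Real.volume_Icc, sub_zero]

lemma gammaInv_eq {κ ρ : ℝ} (hκ : 0 < κ) (hρ : 0 < ρ) :
    gammaInv κ ρ = fun u => sInf {y | u ≤ cdf (gammaMeasure κ (κ / ρ)) y} := by
  funext u
  simp only [gammaInv, gammaCDF, cdf_gammaMeasure_eq_integral hκ (div_pos hκ hρ)]

lemma ae_pi_unifI_injective (V : Type*) [Fintype V] :
    ∀ᵐ x ∂Measure.pi fun _ : V => unifI, Function.Injective x := by
  have h : ∀ i j : V, i ≠ j → ∀ᵐ x : V → ℝ, x i ≠ x j := by
    classical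
    intro i j hij
    let d : (V → ℝ) →ₗ[ℝ] ℝ :=
      (LinearMap.proj i : (V → ℝ) →ₗ[ℝ] ℝ) - (LinearMap.proj j : (V → ℝ) →ₗ[ℝ] ℝ)
    have hs := Measure.addHaar_submodule (volume : Measure (V → ℝ)) (LinearMap.ker d) fun htop => by
      have : (Pi.single i 1 : V → ℝ) ∈ LinearMap.ker d := by
        rw [htop]; trivial
      simp [d, hij] at this
    filter_upwards [measure_eq_zero_iff_ae_notMem.1 hs] with x hx hxy
    exact hx (by simp [d, hxy])
  have h' : ∀ᵐ x : V → ℝ, Function.Injective x := by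
    have h2 : ∀ᵐ x : V → ℝ, ∀ i j, i ≠ j → x i ≠ x j := by
      simp only [ae_all_iff]
      exact h
    filter_upwards [h2] with x hx i j hij
    by_contra hne
    exact hx i j hne hij
  unfold unifI
  rw [← Measure.restrict_pi_pi, ← volume_pi]
  exact ae_restrict_of_ae h'

lemma prod_sym2 {V R : Type*} [Fintype V] [LinearOrder V] [CommMonoid R] (f : Sym2 V → R) :
    ∏ t, f t = ∏ i, ∏ j, if i ≤ j then f s(i, j) else 1 := by
  rw [← Fintype.prod_prod_type' (f := fun i j => if i ≤ j then f s(i, j) else 1),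
    ← Finset.prod_filter (fun p : V × V => p.1 ≤ p.2) (fun p => f s(p.1, p.2)),
    ← Sym2.sortEquiv.symm.prod_comp, ← Finset.prod_subtype_eq_prod_filter, Finset.subtype_univ]
  rfl

lemma measurable_edgeIntensity {V : Type*} [Fintype V] [DecidableEq V] (ρ : ℝ) (t : Sym2 V) :
    Measurable fun x : V → ℝ => edgeIntensity ρ x t := by
  unfold edgeIntensity; fun_prop

lemma measurable_poissonWeight (c : ℕ) : Measurable (poissonWeight c) := by
  unfold poissonWeight; fun_prop

lemma tindW_Wpag {κ ρ : ℝ} (hκ : 0 < κ) (hρ : 0 < ρ) {k : ℕ} {A : Fin k → Fin k → ℕ}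
    {a : Sym2 (Fin k) → ℕ} (ha : ∀ i j, i ≠ j → a s(i, j) = A i j)
    (ha' : ∀ i, 2 * a s(i, i) = A i i) : tindW A (Wpag κ ρ) = limitProb κ ρ id a := by
  have : IsProbabilityMeasure (gammaMeasure κ (κ / ρ)) :=
    isProbabilityMeasure_gammaMeasure hκ (by positivity)
  have hm : AEMeasurable (gammaInv κ ρ) unifI := by
    rw [gammaInv_eq hκ hρ]; exact aemeasurable_sInf_cdf _
  have hmap : unifI.map (gammaInv κ ρ) = gammaMeasure κ (κ / ρ) := by
    rw [gammaInv_eq hκ hρ]; exact map_sInf_cdf _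
  have hpi : (Measure.pi fun _ : Fin k => unifI).map (fun x i => gammaInv κ ρ (x i)) =
      gammaPi (Fin k) κ (κ / ρ) := by
    have : ∀ _ : Fin k, SigmaFinite (unifI.map (gammaInv κ ρ)) := fun _ => by
      rw [hmap]; infer_instance
    rw [Measure.pi_map_pi fun _ => hm, gammaPi]
    simp only [hmap]
  have hmeas : Measurable fun x : Fin k → ℝ =>
      ∏ t, poissonWeight (a t) (edgeIntensity ρ x (id t)) :=
    Finset.measurable_prod _ fun t _ =>
      (measurable_poissonWeight _).comp (measurable_edgeIntensity ρ _)
  rw [limitProb, ← hpi, integral_map ?_ hmeas.aestronglyMeasurable, tindW]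
  · refine integral_congr_ae ?_
    filter_upwards [ae_pi_unifI_injective (Fin k)] with x hx
    rw [prod_sym2]
    refine prod_congr rfl fun i _ => prod_congr rfl fun j _ => ?_
    split_ifs
    · by_cases hij : i = j
      · subst hij
        have hdvd : 2 ∣ A i i := ⟨_, (ha' i).symm⟩
        rw [id, edgeIntensity_self, Wpag, if_pos rfl, if_pos hdvd, ← ha' i,
          Nat.mul_div_cancel_left _ two_pos]
      · rw [id, edgeIntensity_of_ne _ _ hij, Wpag, if_neg (hx.ne hij), ha i j hij]
    · rfl
  · exact aemeasurable_pi_lambda _ fun i =>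
      hm.comp_quasiMeasurePreserving (measurePreserving_eval _ i).quasiMeasurePreserving

end Quantile

/-- Let `X_n` be distributed as `PAG_κ(n, m(n))` with
`2m(n)/n² → ρ ∈ (0,∞)`.  Then `X_n` converges in probability, in the sense of multigraph
homomorphism densities, to the multigraphon `Wpag κ ρ`: for every `k`, every adjacency
matrix `A ∈ A_k` and every `ε > 0`, the probability that
`|t_=(A, X_n) − t_=(A, Wpag κ ρ)| > ε` tends to `0`. -/
theorem pag_converges_to_gamma_poisson_multigraphon (κ ρ : ℝ) (hκ : 0 < κ)
    (hρ : 0 < ρ) (m : ℕ → ℕ)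
    (hm : Tendsto (fun n : ℕ => (2 * m n : ℝ) / (n : ℝ) ^ 2) atTop (nhds ρ))
    (k : ℕ) (A : Fin k → Fin k → ℕ)
    (hsymA : ∀ i j, A i j = A j i) (hevenA : ∀ i, 2 ∣ A i i)
    (ε : ℝ) (hε : 0 < ε) :
    Tendsto
      (fun n : ℕ => ∑ ψ : Fin (2 * m n) → Fin n,
        polyaProb κ ψ *
          (if ε < |tind A (stubAdj ψ) - tindW A (Wpag κ ρ)| then (1:ℝ) else 0))
      atTop (nhds 0) := by
  obtain ⟨a, ha, ha'⟩ := exists_cellCount hsymA hevenA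
  rw [tindW_Wpag hκ hρ ha ha']
  exact tendsto_prob_tind hκ hρ hm ha ha' hε
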